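/- Let 0 < α < 1 and b_j := (j+1)^{1-α} − j^{1-α} for integers j ≥ 0. Let T > 0, δ > 0, and let (E_k)_{k≥0}, (G_k)_{k≥0} be sequences of nonnegative real numbers satisfying: E_0 ≤ G_0; E_1 ≤ E_0 + G_1; and for every integer k ≥ 1, E_{k+1} ≤ (1 − b_1) E_k + ∑_{j=1}^{k-1} (b_j − b_{j+1}) E_{k-j} + b_k E_0 + G_{k+1}. Then for every integer k ≥ 1 with k·δ ≤ T, E_k ≤ (2 T^α/(1 − α)) · δ^{−α} · max_{0 ≤ j ≤ k} G_j. -/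

import Mathlib

/-- The L1 coefficients `b_j = (j+1)^(1-α) - j^(1-α)`. -/
noncomputable def bcoef (α : ℝ) (j : ℕ) : ℝ :=
  ((j : ℝ) + 1) ^ (1 - α) - (j : ℝ) ^ (1 - α)

theorem bcoef_zero {α : ℝ} (hα1 : α < 1) : bcoef α 0 = 1 := by
  have h : (1 - α) ≠ 0 := by linarith
  simp [bcoef, Real.zero_rpow h]

theorem bcoef_succ_le {α : ℝ} (hα0 : 0 < α) (hα1 : α < 1) (j : ℕ) :
    bcoef α (j + 1) ≤ bcoef α j := by
  have hc := Real.concaveOn_rpow (p := 1 - α) (by linarith) (by linarith)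
  have hj : (0 : ℝ) ≤ j := j.cast_nonneg
  have h := hc.slope_anti_adjacent (x := (j : ℝ)) (y := (j : ℝ) + 1) (z := (j : ℝ) + 1 + 1)
    (Set.mem_Ici.mpr hj) (Set.mem_Ici.mpr (by linarith)) (by linarith) (by linarith)
  simpa [bcoef] using h

theorem bcoef_antitone {α : ℝ} (hα0 : 0 < α) (hα1 : α < 1) : Antitone (bcoef α) :=
  antitone_nat_of_succ_le (bcoef_succ_le hα0 hα1)

theorem le_bcoef {α : ℝ} (hα0 : 0 < α) (hα1 : α < 1) (j : ℕ) :
    (1 - α) * ((j : ℝ) + 1) ^ (-α) ≤ bcoef α j := by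
  have hx : (0 : ℝ) < (j : ℝ) + 1 := by positivity
  have hinv : ((j : ℝ) + 1)⁻¹ ≤ 1 := inv_le_one_of_one_le₀ (by simp)
  have hbern := rpow_one_add_le_one_add_mul_self (s := -((j : ℝ) + 1)⁻¹) (p := 1 - α)
    (by linarith) (by linarith) (by linarith)
  have hsplit : (j : ℝ) = ((j : ℝ) + 1) * (1 + -((j : ℝ) + 1)⁻¹) := by
    field_simp
    ring
  have hpow : (j : ℝ) ^ (1 - α)
      = ((j : ℝ) + 1) ^ (1 - α) * (1 + -((j : ℝ) + 1)⁻¹) ^ (1 - α) := by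
    rw [← Real.mul_rpow hx.le (by linarith), ← hsplit]
  have hneg : ((j : ℝ) + 1) ^ (-α) = ((j : ℝ) + 1) ^ (1 - α) * ((j : ℝ) + 1)⁻¹ := by
    rw [← Real.rpow_neg_one, ← Real.rpow_add hx]
    ring_nf
  have hmul := mul_le_mul_of_nonneg_left hbern (Real.rpow_nonneg hx.le (1 - α))
  rw [bcoef, hpow, hneg]
  linarith

theorem bcoef_pos {α : ℝ} (hα0 : 0 < α) (hα1 : α < 1) (j : ℕ) : 0 < bcoef α j :=
  lt_of_lt_of_le (mul_pos (by linarith) (Real.rpow_pos_of_pos (by positivity) _))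
    (le_bcoef hα0 hα1 j)

theorem le_two_mul_div_bcoef {α : ℝ} (hα0 : 0 < α) (hα1 : α < 1)
    {E : ℕ → ℝ} {M : ℝ} {n : ℕ} (hM : 0 ≤ M) (h0 : E 0 ≤ M) (h1 : E 1 ≤ E 0 + M)
    (hrec : ∀ k : ℕ, 1 ≤ k → k < n →
      E (k + 1) ≤ (1 - bcoef α 1) * E k
        + (∑ j ∈ Finset.Ico 1 k, (bcoef α j - bcoef α (j + 1)) * E (k - j))
        + bcoef α k * E 0 + M)
    (k : ℕ) (hk : k < n) : E (k + 1) ≤ 2 * M / bcoef α k := by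
  induction k using Nat.strong_induction_on with
  | _ k ih =>
    rcases Nat.eq_zero_or_pos k with rfl | hpos
    · rw [bcoef_zero hα1]
      linarith
    have hb := bcoef_pos hα0 hα1 k
    have hb1 : bcoef α k ≤ 1 :=
      bcoef_zero hα1 ▸ bcoef_antitone hα0 hα1 (Nat.zero_le k)
    have hb01 : bcoef α 1 ≤ 1 :=
      bcoef_zero hα1 ▸ bcoef_antitone hα0 hα1 (Nat.zero_le 1)
    set C := 2 * M / bcoef α k with hC
    have hprev : ∀ m, 1 ≤ m → m ≤ k → E m ≤ C := by
      intro m hm hmk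
      obtain ⟨i, rfl⟩ := Nat.exists_eq_add_of_le' hm
      exact (ih i (by omega) (by omega)).trans
        (div_le_div_of_nonneg_left (by linarith) hb
          (bcoef_antitone hα0 hα1 (by omega)))
    have hsum : ∑ j ∈ Finset.Ico 1 k, (bcoef α j - bcoef α (j + 1)) * E (k - j)
        ≤ (bcoef α 1 - bcoef α k) * C := by
      calc _ ≤ ∑ j ∈ Finset.Ico 1 k, (bcoef α j - bcoef α (j + 1)) * C := by
            refine Finset.sum_le_sum fun j hj => ?_
            rw [Finset.mem_Ico] at hj
            exact mul_le_mul_of_nonneg_left (hprev _ (by omega) (by omega))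
              (sub_nonneg.mpr (bcoef_succ_le hα0 hα1 j))
        _ = _ := by
            rw [← Finset.sum_mul]
            congr 1
            have h := Finset.sum_Ico_sub (bcoef α) hpos
            rw [← neg_inj, ← Finset.sum_neg_distrib]
            simpa using h
    have hfirst := mul_le_mul_of_nonneg_left (hprev k hpos le_rfl) (sub_nonneg.mpr hb01)
    have hlast := mul_le_mul_of_nonneg_left h0 hb.le
    have hbM := mul_le_mul_of_nonneg_right hb1 hM
    have hCb : bcoef α k * C = 2 * M := by
      rw [hC]
      field_simp
    linarith [hrec k hpos hk]

theorem discrete_fractional_gronwall_stability (α : ℝ) (hα0 : 0 < α) (hα1 : α < 1)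
    (T δ : ℝ) (hT : 0 < T) (hδ : 0 < δ)
    (E G : ℕ → ℝ) (hE : ∀ k, 0 ≤ E k) (hG : ∀ k, 0 ≤ G k)
    (h0 : E 0 ≤ G 0) (h1 : E 1 ≤ E 0 + G 1)
    (hrec : ∀ k : ℕ, 1 ≤ k →
      E (k + 1) ≤ (1 - bcoef α 1) * E k
        + (∑ j ∈ Finset.Ico 1 k, (bcoef α j - bcoef α (j + 1)) * E (k - j))
        + bcoef α k * E 0 + G (k + 1)) :
    ∀ k : ℕ, 1 ≤ k → (k : ℝ) * δ ≤ T →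
      E k ≤ (2 * T ^ α / (1 - α)) * δ ^ (-α)
              * (Finset.range (k + 1)).sup' (Finset.nonempty_range_iff.mpr k.succ_ne_zero) G := by
  intro k hk hkT
  set M := (Finset.range (k + 1)).sup' (Finset.nonempty_range_iff.mpr k.succ_ne_zero) G
  have hGM : ∀ j ≤ k, G j ≤ M := fun j hj =>
    Finset.le_sup' G (Finset.mem_range.mpr (by omega))
  have hM : 0 ≤ M := (hG 0).trans (hGM 0 (Nat.zero_le k))
  obtain ⟨i, rfl⟩ := Nat.exists_eq_add_of_le' hk
  have hbound := le_two_mul_div_bcoef (n := i + 1) hα0 hα1 hM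
    (h0.trans (hGM 0 (by omega))) (h1.trans (by linarith [hGM 1 (by omega)]))
    (fun m hm hmi => (hrec m hm).trans (by linarith [hGM (m + 1) (by omega)]))
    i (by omega)
  have hα : 0 < 1 - α := by linarith
  push_cast at hkT
  have hi : (0 : ℝ) < (i : ℝ) + 1 := by positivity
  have hpow : ((i : ℝ) + 1) ^ α ≤ T ^ α * δ ^ (-α) := by
    rw [Real.rpow_neg hδ.le, ← div_eq_mul_inv, le_div_iff₀ (Real.rpow_pos_of_pos hδ α),
      ← Real.mul_rpow hi.le hδ.le]
    exact Real.rpow_le_rpow (by positivity) hkT hα0.le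
  calc E (i + 1) ≤ 2 * M / bcoef α i := hbound
    _ ≤ 2 * M / ((1 - α) * ((i : ℝ) + 1) ^ (-α)) :=
        div_le_div_of_nonneg_left (by linarith)
          (mul_pos hα (Real.rpow_pos_of_pos hi _)) (le_bcoef hα0 hα1 i)
    _ = 2 * M / (1 - α) * ((i : ℝ) + 1) ^ α := by
        rw [Real.rpow_neg hi.le, ← div_div, div_inv_eq_mul]
    _ ≤ 2 * M / (1 - α) * (T ^ α * δ ^ (-α)) :=
        mul_le_mul_of_nonneg_left hpow (by positivity)
    _ = _ := by ring
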